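/- Let Γ be a commutative thick weakly distance-regular digraph with Γ_{1,q-1}^2 = {Γ_{2,q-2}}. If Γ_{1,p-1}^2 ∩ Γ_{1,q-1}Γ_{q-1,1} ≠ ∅ and Γ_{1,p-1}Γ_{1,q-1} = {Γ_{2,q}}, then Γ_{1,p-1}Γ_{1,q-1}^2 = {Γ_{3,q-1}}. -/

import Mathlib

/-!
Common framework: commutative thick weakly distance-regular digraphs.
-/

variable {V : Type*}

/-- There is a directed walk of length `n` from `x` to `y`. -/
def HasWalk (adj : V → V → Prop) (x y : V) (n : ℕ) : Prop :=
  ∃ f : ℕ → V, f 0 = x ∧ f n = y ∧ ∀ i < n, adj (f i) (f (i + 1))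

/-- Directed distance `∂(x,y)`. -/
noncomputable def ddist (adj : V → V → Prop) (x y : V) : ℕ :=
  sInf {n | HasWalk adj x y n}

/-- Two-way distance `∂̃(x,y) = (∂(x,y), ∂(y,x))`. -/
noncomputable def tdist (adj : V → V → Prop) (x y : V) : ℕ × ℕ :=
  (ddist adj x y, ddist adj y x)

/-- The pair `i` is an attained two-way distance, i.e. `i ∈ ∂̃(Γ)`. -/
def Attained (adj : V → V → Prop) (i : ℕ × ℕ) : Prop :=
  ∃ x y : V, tdist adj x y = i

/-- Intersection number `p^h_{i,j}`: for attained `h` it is the common cardinality of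
`{z | ∂̃(x,z) = i, ∂̃(z,y) = j}` over pairs with `∂̃(x,y) = h` (and `0` otherwise). -/
noncomputable def pnum (adj : V → V → Prop) (h i j : ℕ × ℕ) : ℕ :=
  sSup {n | ∃ x y : V, tdist adj x y = h ∧
    n = Set.ncard {z : V | tdist adj x z = i ∧ tdist adj z y = j}}

/-- Valency `k_i = |Γ_i(x)|`. -/
noncomputable def kval (adj : V → V → Prop) (i : ℕ × ℕ) : ℕ :=
  pnum adj (0, 0) i i.swap

/-- Adjacency of the subdigraph `Δ_J`: arcs of type `(1, t-1)` for `t ∈ J`. -/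
def deltaAdj (adj : V → V → Prop) (J : Set ℕ) (u v : V) : Prop :=
  ∃ t ∈ J, tdist adj u v = (1, t - 1)

/-- A circuit of length `s`. -/
def IsCircuit (adj : V → V → Prop) (s : ℕ) (f : ℕ → V) : Prop :=
  0 < s ∧ f s = f 0 ∧ ∀ i < s, adj (f i) (f (i + 1))

/-- Strongly connected. -/
def IsStrong (adj : V → V → Prop) : Prop :=
  ∀ x y : V, ∃ n, HasWalk adj x y n

/-- Weakly distance-regular: the intersection numbers are well defined. -/
def IsWDR (adj : V → V → Prop) : Prop :=
  ∀ (i j : ℕ × ℕ) (x y x' y' : V), tdist adj x y = tdist adj x' y' →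
    Set.ncard {z : V | tdist adj x z = i ∧ tdist adj z y = j}
      = Set.ncard {z : V | tdist adj x' z = i ∧ tdist adj z y' = j}

/-- Thick: `p^h_{i,i}, p^h_{i,i*} ∈ {0, k_i}`. -/
def IsThick (adj : V → V → Prop) : Prop :=
  ∀ h i : ℕ × ℕ,
    (pnum adj h i i = 0 ∨ pnum adj h i i = kval adj i) ∧
    (pnum adj h i i.swap = 0 ∨ pnum adj h i i.swap = kval adj i)

/-- A thick weakly distance-regular digraph (as a property of an adjacency relation). -/
def IsWDRThick (adj : V → V → Prop) : Prop :=
  IsStrong adj ∧ IsWDR adj ∧ IsThick adj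

/-- A commutative thick weakly distance-regular digraph. -/
structure CTWDR (V : Type*) [Fintype V] where
  adj : V → V → Prop
  loopless : ∀ v, ¬ adj v v
  strong : IsStrong adj
  wdr : IsWDR adj
  comm : ∀ (i j : ℕ × ℕ) (x y : V),
    Set.ncard {z : V | tdist adj x z = i ∧ tdist adj z y = j}
      = Set.ncard {z : V | tdist adj x z = j ∧ tdist adj z y = i}
  thick : IsThick adj

namespace CTWDR

variable {V : Type*} [Fintype V] (G : CTWDR V)

/-- Product `EF` of two sets of relations (relations identified with two-way distances). -/
def prodS (E F : Set (ℕ × ℕ)) : Set (ℕ × ℕ) :=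
  {h | ∃ i ∈ E, ∃ j ∈ F, pnum G.adj h i j ≠ 0}

/-- Powers `Γ_i^l` (with `Γ_i^0 = {Γ_{(0,0)}}` and `Γ_i^1 = {Γ_i}`). -/
def pow (i : ℕ × ℕ) : ℕ → Set (ℕ × ℕ)
  | 0 => {(0, 0)}
  | 1 => {i}
  | n + 2 => G.prodS (pow i (n + 1)) {i}

/-- The pair `(1, s-1)` is pure: every circuit of length `s` containing an arc of type
`(1, s-1)` consists of arcs of type `(1, s-1)`. -/
def Pure (s : ℕ) : Prop :=
  ∀ f : ℕ → V, IsCircuit G.adj s f →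
    (∃ i < s, tdist G.adj (f i) (f (i + 1)) = (1, s - 1)) →
    ∀ i < s, tdist G.adj (f i) (f (i + 1)) = (1, s - 1)

/-- `(1, s-1)` is mixed. -/
def Mixed (s : ℕ) : Prop := ¬ G.Pure s

/-- Configuration `C(q)` exists. -/
def Cexists (q : ℕ) : Prop :=
  pnum G.adj (1, q - 2) (1, q - 1) (1, q - 1) ≠ 0 ∧ G.Pure (q - 1)

/-- Configuration `D(q)` exists. -/
def Dexists (q : ℕ) : Prop :=
  pnum G.adj (1, q - 1) (1, q - 2) (q - 2, 1) ≠ 0 ∧ G.Pure (q - 1)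

/-- A closed set of relations: `Γ_{i*}Γ_j ⊆ F` for all `i, j ∈ F`. -/
def Closed (F : Set (ℕ × ℕ)) : Prop :=
  ∀ i ∈ F, ∀ j ∈ F, G.prodS {i.swap} {j} ⊆ F

/-- The minimal closed set `⟨F⟩` containing `F`. -/
def genClosed (F : Set (ℕ × ℕ)) : Set (ℕ × ℕ) :=
  ⋂₀ {C | F ⊆ C ∧ G.Closed C}

/-- The block `F_J(x)` of the closed set generated by `{Γ_{1,t-1}}_{t ∈ J}`. -/
def block (J : Set ℕ) (x : V) : Set V :=
  {y | tdist G.adj x y ∈ G.genClosed {i | ∃ t ∈ J, i = (1, t - 1)}}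

end CTWDR

namespace CTWDR

section aux
variable {V : Type*} [Fintype V] (G : CTWDR V)

lemma walk_dd (x y : V) : HasWalk G.adj x y (ddist G.adj x y) :=
  Nat.sInf_mem (s := {n | HasWalk G.adj x y n}) (G.strong x y)

lemma dd_le {x y : V} {n : ℕ} (h : HasWalk G.adj x y n) : ddist G.adj x y ≤ n :=
  Nat.sInf_le h

lemma dd_self (x : V) : ddist G.adj x x = 0 := by
  have := G.dd_le (x := x) (y := x) (n := 0) ⟨fun _ => x, rfl, rfl, by simp⟩
  omega

lemma dd_zero {x y : V} (h : ddist G.adj x y = 0) : x = y := by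
  have hw := G.walk_dd x y
  rw [h] at hw
  obtain ⟨f, h0, h1, -⟩ := hw
  rw [← h0, ← h1]

lemma walk_trans {x y z : V} {m n : ℕ} (h : HasWalk G.adj x y m) (h' : HasWalk G.adj y z n) :
    HasWalk G.adj x z (m + n) := by
  obtain ⟨f, f0, fm, hf⟩ := h
  obtain ⟨g, g0, gn, hg⟩ := h'
  refine ⟨fun i => if i < m then f i else g (i - m), ?_, ?_, ?_⟩
  · by_cases hm : 0 < m
    · simp [hm, f0]
    · have : m = 0 := by omega
      subst this
      simp [g0, ← fm, f0]
  · simp [gn]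
  · intro i hi
    by_cases h1 : i + 1 < m
    · have h2 : i < m := by omega
      simpa [h1, h2] using hf i h2
    · by_cases h2 : i < m
      · have h3 : i + 1 = m := by omega
        have := hf i h2
        rw [h3, fm] at this
        simpa [h2, h3, g0] using this
      · have h3 : i + 1 - m = (i - m) + 1 := by omega
        simp only [h1, h2, if_false, h3]
        exact hg _ (by omega)

lemma tri (x y z : V) : ddist G.adj x z ≤ ddist G.adj x y + ddist G.adj y z :=
  G.dd_le (G.walk_trans (G.walk_dd x y) (G.walk_dd y z))

lemma first_step {s y : V} {n : ℕ} (h : ddist G.adj s y = n + 1) :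
    ∃ t, ddist G.adj s t = 1 ∧ ddist G.adj t y = n := by
  have hw := G.walk_dd s y
  rw [h] at hw
  obtain ⟨f, f0, fn, hf⟩ := hw
  have a1 : ddist G.adj s (f 1) ≤ 1 :=
    G.dd_le ⟨f, f0, rfl, fun i hi => hf i (by omega)⟩
  have a2 : ddist G.adj (f 1) y ≤ n :=
    G.dd_le ⟨fun i => f (i + 1), rfl, fn, fun i hi => hf (i + 1) (by omega)⟩
  have := G.tri s (f 1) y
  exact ⟨f 1, by omega, by omega⟩

lemma td_swap {x y : V} {i : ℕ × ℕ} (h : tdist G.adj x y = i) : tdist G.adj y x = i.swap := by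
  subst h; rfl

lemma pnum_eq {x y : V} {h i j : ℕ × ℕ} (hxy : tdist G.adj x y = h) :
    pnum G.adj h i j = Set.ncard {z : V | tdist G.adj x z = i ∧ tdist G.adj z y = j} := by
  unfold pnum
  have : {n | ∃ x y : V, tdist G.adj x y = h ∧
    n = Set.ncard {z : V | tdist G.adj x z = i ∧ tdist G.adj z y = j}} =
    {Set.ncard {z : V | tdist G.adj x z = i ∧ tdist G.adj z y = j}} := by
    ext n
    constructor
    · rintro ⟨x', y', h', rfl⟩
      exact G.wdr i j x' y' x y (h'.trans hxy.symm)
    · rintro rfl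
      exact ⟨x, y, hxy, rfl⟩
  rw [this, csSup_singleton]

lemma nc_ne {x y : V} {i j : ℕ × ℕ} :
    Set.ncard {z : V | tdist G.adj x z = i ∧ tdist G.adj z y = j} ≠ 0 ↔
      ∃ z, tdist G.adj x z = i ∧ tdist G.adj z y = j := by
  rw [← Nat.pos_iff_ne_zero, Set.ncard_pos (Set.toFinite _)]
  rfl

lemma pnum_ne {h i j : ℕ × ℕ} : pnum G.adj h i j ≠ 0 ↔
    ∃ x z y, tdist G.adj x y = h ∧ tdist G.adj x z = i ∧ tdist G.adj z y = j := by
  constructor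
  · intro hne
    by_cases hatt : ∃ x y, tdist G.adj x y = h
    · obtain ⟨x, y, hxy⟩ := hatt
      rw [G.pnum_eq hxy, nc_ne] at hne
      obtain ⟨z, hz⟩ := hne
      exact ⟨x, z, y, hxy, hz⟩
    · exfalso
      apply hne
      unfold pnum
      have : {n | ∃ x y : V, tdist G.adj x y = h ∧
        n = Set.ncard {z : V | tdist G.adj x z = i ∧ tdist G.adj z y = j}} = ∅ := by
        ext n
        simp only [Set.mem_setOf_eq, Set.mem_empty_iff_false, iff_false]
        rintro ⟨x, y, h', -⟩
        exact hatt ⟨x, y, h'⟩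
      rw [this]; simp
  · rintro ⟨x, z, y, h1, h2⟩
    rw [G.pnum_eq h1, nc_ne]
    exact ⟨z, h2⟩

lemma transfer {x y x' y' z : V} {i j : ℕ × ℕ} (h : tdist G.adj x y = tdist G.adj x' y')
    (h1 : tdist G.adj x z = i) (h2 : tdist G.adj z y = j) :
    ∃ z', tdist G.adj x' z' = i ∧ tdist G.adj z' y' = j := by
  rw [← nc_ne, ← G.wdr i j x y x' y' h, nc_ne]
  exact ⟨z, h1, h2⟩

lemma commute {x y z : V} {i j : ℕ × ℕ}
    (h1 : tdist G.adj x z = i) (h2 : tdist G.adj z y = j) :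
    ∃ z', tdist G.adj x z' = j ∧ tdist G.adj z' y = i := by
  rw [← nc_ne, ← G.comm i j x y, nc_ne]
  exact ⟨z, h1, h2⟩

/-- regularity from thickness -/
lemma reg {i : ℕ × ℕ} {u u' v v' : V} (h1 : tdist G.adj u v = i) (h2 : tdist G.adj u' v = i)
    (h3 : tdist G.adj u v' = i) : tdist G.adj u' v' = i := by
  have huu : tdist G.adj u u = (0, 0) := by simp [tdist, dd_self]
  have hne : pnum G.adj (tdist G.adj u u') i i.swap ≠ 0 :=
    G.pnum_ne.2 ⟨u, v, u', rfl, h1, G.td_swap h2⟩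
  have he := (G.thick (tdist G.adj u u') i).2.resolve_left hne
  unfold kval at he
  rw [G.pnum_eq (x := u) (y := u') rfl, G.pnum_eq huu] at he
  have hsub : {z : V | tdist G.adj u z = i ∧ tdist G.adj z u' = i.swap} ⊆
      {z : V | tdist G.adj u z = i ∧ tdist G.adj z u = i.swap} :=
    fun z hz => ⟨hz.1, G.td_swap hz.1⟩
  have := Set.eq_of_subset_of_ncard_le hsub he.ge (Set.toFinite _)
  have hm : v' ∈ {z : V | tdist G.adj u z = i ∧ tdist G.adj z u = i.swap} :=
    ⟨h3, G.td_swap h3⟩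
  rw [← this] at hm
  exact G.td_swap hm.2

/-- common in-neighbour gives the same out-neighbours -/
lemma reg' {i : ℕ × ℕ} {u u' v v' : V} (h1 : tdist G.adj v u = i) (h2 : tdist G.adj v u' = i)
    (h3 : tdist G.adj u v' = i) : tdist G.adj u' v' = i := by
  obtain ⟨z, hz1, hz2⟩ := G.commute (G.td_swap h1) h2
  exact G.reg hz1 (G.td_swap hz2) h3

lemma mem_prod {h i j : ℕ × ℕ} : h ∈ G.prodS {i} {j} ↔
    ∃ x z y, tdist G.adj x y = h ∧ tdist G.adj x z = i ∧ tdist G.adj z y = j := by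
  simp only [prodS, Set.mem_singleton_iff, exists_eq_left, Set.mem_setOf_eq, G.pnum_ne]

lemma pow_two' (i : ℕ × ℕ) : G.pow i 2 = G.prodS {i} {i} := rfl

/-- A geodesic closing `A A` consists of `A`-arcs. -/
lemma back {q : ℕ} (hq3 : 3 ≤ q)
    (hA2 : ∀ u w, tdist G.adj u w = (2, q - 2) →
      ∃ v, tdist G.adj u v = (1, q - 1) ∧ tdist G.adj v w = (1, q - 1))
    {y z w : V} (hyz : tdist G.adj y z = (1, q - 1)) (hzw : tdist G.adj z w = (1, q - 1))
    (hyw : tdist G.adj y w = (2, q - 2)) :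
    ∃ u, tdist G.adj u y = (1, q - 1) ∧ ddist G.adj w u ≤ q - 3 := by
  have key : ∀ k, k ≤ q - 2 → ∃ r s, tdist G.adj r s = (1, q - 1) ∧ ddist G.adj z r ≤ k ∧
      ddist G.adj s y = q - 2 - k ∧ ddist G.adj w s ≤ k ∧ (1 ≤ k → ddist G.adj w r ≤ k - 1) := by
    intro k
    induction k with
    | zero =>
      intro _
      refine ⟨z, w, hzw, by simp [dd_self], ?_, by simp [dd_self], by simp⟩
      simpa [tdist] using congrArg Prod.snd hyw
    | succ k ih =>
      intro hk
      obtain ⟨r, s, hrs, hzr, hsy, hws, -⟩ := ih (by omega)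
      obtain ⟨t, hst, hty⟩ := G.first_step (s := s) (y := y) (n := q - 3 - k) (by omega)
      have e1 : ddist G.adj r s = 1 := congrArg Prod.fst hrs
      have e2 : ddist G.adj s r = q - 1 := congrArg Prod.snd hrs
      have e3 : ddist G.adj y z = 1 := congrArg Prod.fst hyz
      have e4 : ddist G.adj z y = q - 1 := congrArg Prod.snd hyz
      have t1 := G.tri r s t
      have t2 := G.tri s t r
      have t3 := G.tri t y r
      have t4 := G.tri y z r
      have t5 := G.tri z r y
      have t6 := G.tri r t y
      have t7 := G.tri z r s
      have t8 := G.tri w s t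
      have f1 : ddist G.adj t r = q - 2 := by omega
      have f2 : ddist G.adj r t = 2 := by omega
      obtain ⟨v, hv1, hv2⟩ := hA2 r t (by simp [tdist, f1, f2])
      have hA := G.reg' hv1 hrs hv2
      refine ⟨s, t, hA, by omega, by omega, by omega, fun _ => by simpa using hws⟩
  obtain ⟨r, s, hrs, -, hsy, -, hwr⟩ := key (q - 2) le_rfl
  have := G.dd_zero (x := s) (y := y) (by omega)
  subst this
  exact ⟨r, hrs, by have := hwr (by omega); omega⟩

end aux

end CTWDR

/-- Lemma 4.3: if `Γ_{1,q-1}^2 = {Γ_{2,q-2}}`,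
`Γ_{1,p-1}^2 ∩ Γ_{1,q-1}Γ_{q-1,1} ≠ ∅` and `Γ_{1,p-1}Γ_{1,q-1} = {Γ_{2,q}}`, then
`Γ_{1,p-1}Γ_{1,q-1}^2 = {Γ_{3,q-1}}`. -/
theorem stmt13 {V : Type*} [Fintype V] (G : CTWDR V) (p q : ℕ)
    (hp : Attained G.adj (1, p - 1)) (hq : Attained G.adj (1, q - 1))
    (h1 : G.pow (1, q - 1) 2 = {(2, q - 2)})
    (hcap : (G.pow (1, p - 1) 2 ∩ G.prodS {(1, q - 1)} {(q - 1, 1)}).Nonempty)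
    (hprod : G.prodS {(1, p - 1)} {(1, q - 1)} = {(2, q)}) :
    G.prodS {(1, p - 1)} (G.pow (1, q - 1) 2) = {(3, q - 1)} := by
  classical
  rw [h1]
  rw [G.pow_two'] at h1 hcap
  have AA : ∀ u v w, tdist G.adj u v = (1, q - 1) → tdist G.adj v w = (1, q - 1) →
      tdist G.adj u w = (2, q - 2) := by
    intro u v w a b
    have : tdist G.adj u w ∈ G.prodS {(1, q - 1)} {(1, q - 1)} :=
      G.mem_prod.2 ⟨u, v, w, rfl, a, b⟩
    rw [h1] at this
    exact this
  have BA : ∀ u v w, tdist G.adj u v = (1, p - 1) → tdist G.adj v w = (1, q - 1) →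
      tdist G.adj u w = (2, q) := by
    intro u v w a b
    have : tdist G.adj u w ∈ G.prodS {(1, p - 1)} {(1, q - 1)} :=
      G.mem_prod.2 ⟨u, v, w, rfl, a, b⟩
    rw [hprod] at this
    exact this
  have hmem : (2, q - 2) ∈ G.prodS {(1, q - 1)} {(1, q - 1)} := by rw [h1]; rfl
  obtain ⟨a0, a1, a2, ha, ha1, ha2⟩ := G.mem_prod.1 hmem
  have hA2 : ∀ u w, tdist G.adj u w = (2, q - 2) →
      ∃ v, tdist G.adj u v = (1, q - 1) ∧ tdist G.adj v w = (1, q - 1) := by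
    intro u w h
    exact G.transfer (ha.trans h.symm) ha1 ha2
  have hq3 : 3 ≤ q := by
    by_contra hlt
    have e1 : ddist G.adj a0 a2 = 2 := congrArg Prod.fst ha
    have e2 : ddist G.adj a2 a0 = q - 2 := congrArg Prod.snd ha
    have := G.dd_zero (x := a2) (y := a0) (by omega)
    subst this
    rw [G.dd_self] at e1
    omega
  -- the involution property
  obtain ⟨h, hh1, hh2⟩ := hcap
  obtain ⟨x0, u0, y0, k1, k2, k3⟩ := G.mem_prod.1 hh1
  obtain ⟨x1, u1, y1, l1, l2, l3⟩ := G.mem_prod.1 hh2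
  have L5 : ∀ z w, tdist G.adj z w = (1, p - 1) → ∃ w', tdist G.adj w w' = (1, p - 1) ∧
      ∃ v, tdist G.adj z v = (1, q - 1) ∧ tdist G.adj w' v = (1, q - 1) := by
    intro z w hzw
    obtain ⟨w', c1, c2⟩ := G.transfer (k2.trans hzw.symm) k1 (G.td_swap k3)
    obtain ⟨v, d1, d2⟩ := G.transfer (l1.trans c1.symm) l2 l3
    exact ⟨w', G.td_swap c2, v, d1, G.td_swap d2⟩
  -- main
  have main : ∀ x y w, tdist G.adj x y = (1, p - 1) → tdist G.adj y w = (2, q - 2) →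
      tdist G.adj x w = (3, q - 1) := by
    intro x y w hxy hyw
    obtain ⟨z, hyz, hzw⟩ := hA2 y w hyw
    -- backward distance
    have hxz := BA x y z hxy hyz
    obtain ⟨y2, m1, m2⟩ := G.commute hxy hyz
    obtain ⟨z2, n1, n2⟩ := G.commute m2 hzw
    obtain ⟨w', o1, v, o2, o3⟩ := L5 z2 w n2
    obtain ⟨t, o4, o5⟩ := G.commute o2 (G.td_swap o3)
    have o6 : tdist G.adj y2 w' = (1, q - 1) := G.reg (G.td_swap o4) n1 o5
    have o7 := AA x y2 w' m1 o6
    have e1 : ddist G.adj z x = q := congrArg Prod.snd hxz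
    have e2 : ddist G.adj z w = 1 := congrArg Prod.fst hzw
    have e3 : ddist G.adj w w' = 1 := congrArg Prod.fst o1
    have e4 : ddist G.adj w' x = q - 2 := congrArg Prod.snd o7
    have t1 := G.tri z w x
    have t2 := G.tri w w' x
    -- forward distance
    obtain ⟨u, hu, hwu⟩ := G.back hq3 hA2 hyz hzw hyw
    obtain ⟨x', r1, v', r2, r3⟩ := L5 x y hxy
    obtain ⟨s, s1, s2⟩ := G.commute hu r1
    obtain ⟨t', r4, r5⟩ := G.commute r3 (G.td_swap r2)
    have s3 : tdist G.adj s x = (1, q - 1) := G.reg (G.td_swap r4) s2 r5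
    have s4 := BA u s x s1 s3
    have e5 : ddist G.adj x u = q := congrArg Prod.snd s4
    have e6 : ddist G.adj x y = 1 := congrArg Prod.fst hxy
    have e7 : ddist G.adj y w = 2 := congrArg Prod.fst hyw
    have t3 := G.tri x w u
    have t4 := G.tri x y w
    have e8 : ddist G.adj x w = 3 := by omega
    have e9 : ddist G.adj w x = q - 1 := by omega
    simp [tdist, e8, e9]
  ext i
  rw [G.mem_prod, Set.mem_singleton_iff]
  constructor
  · rintro ⟨x, y, w, rfl, b1, b2⟩
    exact main x y w b1 b2
  · rintro rfl
    obtain ⟨x, y, hxy⟩ := hp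
    obtain ⟨z, g1, -⟩ := G.transfer (x := a0) (y := a0) (x' := y) (y' := y)
      (by simp [tdist, G.dd_self]) ha (G.td_swap ha)
    exact ⟨x, y, z, main x y z hxy g1, hxy, g1⟩
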